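/- Let N ≥ 1, let E ⊆ ℝ^N be Lebesgue-measurable, and let ρ > 0. Define the essential boundary ∂^e E := {z ∈ ℝ^N : |E ∩ B(z, r)| > 0 and |B(z, r) \ E| > 0 for every r > 0}. Then {x ∈ ℝ^N : |E ∩ B(x, ρ)| > 0 and |B(x, ρ) \ E| > 0} = {x ∈ ℝ^N : dist(x, ∂^e E) < ρ}. Consequently, ∫_{ℝ^N} osc_{B(x,ρ)}(χ_E) dx equals the Lebesgue measure of the open ρ-neighborhood {x : dist(x, ∂^e E) < ρ} of ∂^e E, where osc_A(u) := ess sup_A u − ess inf_A u denotes the essential oscillation. -/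

import Mathlib

open MeasureTheory Filter Set
open scoped ENNReal

/-- The essential boundary of a measurable set `E`: the points `z` such that every ball
around `z` meets both `E` and its complement in positive measure. -/
def essBoundary {N : ℕ} (E : Set (EuclideanSpace ℝ (Fin N))) :
    Set (EuclideanSpace ℝ (Fin N)) :=
  {z | ∀ r > (0:ℝ), 0 < volume (E ∩ Metric.ball z r) ∧ 0 < volume (Metric.ball z r \ E)}

/-- The essential oscillation of the characteristic function of `E` over the ball
`B(x, ρ)`: `ess sup − ess inf` with respect to the restricted Lebesgue measure. -/
noncomputable def oscBall {N : ℕ} (E : Set (EuclideanSpace ℝ (Fin N))) (ρ : ℝ)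
    (x : EuclideanSpace ℝ (Fin N)) : ℝ :=
  essSup (E.indicator fun _ => (1:ℝ)) (volume.restrict (Metric.ball x ρ)) -
    essInf (E.indicator fun _ => (1:ℝ)) (volume.restrict (Metric.ball x ρ))

/-- A preconnected set meeting both `E` and its complement in positive measure contains a point
lying in the supports of both restrictions of the measure. -/
lemma IsPreconnected.inter_support_restrict_nonempty {X : Type*} [TopologicalSpace X]
    [HereditarilyLindelofSpace X] [MeasurableSpace X] {μ : Measure X}
    [μ.IsOpenPosMeasure] {s E : Set X} (hs : IsPreconnected s) (hE : MeasurableSet E)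
    (h₁ : 0 < μ (E ∩ s)) (h₂ : 0 < μ (s \ E)) :
    (s ∩ ((μ.restrict E).support ∩ (μ.restrict Eᶜ).support)).Nonempty := by
  refine isPreconnected_closed_iff.1 hs _ _ Measure.isClosed_support Measure.isClosed_support
    ?_ (Measure.nonempty_inter_support_of_pos ?_) (Measure.nonempty_inter_support_of_pos ?_)
  · rw [← Measure.support_add, Measure.restrict_add_restrict_compl hE, Measure.support_eq_univ]
    exact subset_univ s
  · rwa [Measure.restrict_apply' hE, inter_comm]
  · rwa [Measure.restrict_apply' hE.compl, ← sdiff_eq]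

lemma essSup_indicator_one {α : Type*} [MeasurableSpace α] {μ : Measure α} {E : Set α}
    (hE : μ E ≠ 0) : essSup (E.indicator fun _ => (1 : ℝ)) μ = 1 := by
  rw [essSup_eq_sInf]
  convert! csInf_Ici (a := (1 : ℝ)) using 2
  ext a
  refine ⟨fun ha => mem_Ici.2 <| not_lt.1 fun h =>
    hE (measure_mono_null (fun x hx => ?_) ha), fun ha => ?_⟩
  · simpa [hx] using h
  · refine measure_mono_null (fun x hx => ?_) measure_empty
    exact (not_lt.2 ((indicator_le_self' (fun _ _ => zero_le_one) x).trans (mem_Ici.1 ha))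
      (mem_ofPred.1 hx)).elim

lemma essInf_indicator_one {α : Type*} [MeasurableSpace α] {μ : Measure α} {E : Set α}
    (hE : μ Eᶜ ≠ 0) : essInf (E.indicator fun _ => (1 : ℝ)) μ = 0 := by
  rw [essInf_eq_sSup]
  convert! csSup_Iic (a := (0 : ℝ)) using 2
  ext a
  refine ⟨fun ha => mem_Iic.2 <| not_lt.1 fun h =>
    hE (measure_mono_null (fun x hx => ?_) ha), fun ha => ?_⟩
  · simpa [indicator_of_notMem hx] using h
  · refine measure_mono_null (fun x hx => ?_) measure_empty
    exact (not_lt.2 (le_trans (mem_Iic.1 ha) (indicator_nonneg (fun _ _ => zero_le_one) x))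
      (mem_ofPred.1 hx)).elim

lemma essSup_sub_essInf_eq_zero_of_ae_eq_const {α : Type*} [MeasurableSpace α] {μ : Measure α}
    (hμ : μ ≠ 0) {f : α → ℝ} {c : ℝ} (hf : f =ᵐ[μ] fun _ => c) : essSup f μ - essInf f μ = 0 := by
  rw [essSup_congr_ae hf, essInf_congr_ae hf, essSup_const c hμ, essInf_const c hμ, sub_self]

lemma mem_essBoundary_iff {N : ℕ} {E : Set (EuclideanSpace ℝ (Fin N))} (hE : MeasurableSet E)
    {z : EuclideanSpace ℝ (Fin N)} :
    z ∈ essBoundary E ↔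
      z ∈ (volume.restrict E).support ∩ (volume.restrict Eᶜ).support := by
  rw [mem_inter_iff, Metric.nhds_basis_ball.mem_measureSupport,
    Metric.nhds_basis_ball.mem_measureSupport]
  simp only [Measure.restrict_apply' hE, Measure.restrict_apply' hE.compl, ← sdiff_eq,
    inter_comm _ E]
  exact ⟨fun h => ⟨fun r hr => (h r hr).1, fun r hr => (h r hr).2⟩,
    fun h r hr => ⟨h.1 r hr, h.2 r hr⟩⟩

lemma mem_thickening_essBoundary_iff {N : ℕ} {E : Set (EuclideanSpace ℝ (Fin N))}
    (hE : MeasurableSet E) {ρ : ℝ} {x : EuclideanSpace ℝ (Fin N)} :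
    x ∈ Metric.thickening ρ (essBoundary E) ↔
      0 < volume (E ∩ Metric.ball x ρ) ∧ 0 < volume (Metric.ball x ρ \ E) := by
  rw [Metric.mem_thickening_iff]
  constructor
  · rintro ⟨z, hz, hxz⟩
    have hsub : Metric.ball z (ρ - dist x z) ⊆ Metric.ball x ρ :=
      Metric.ball_subset_ball' (by rw [dist_comm z x]; linarith)
    obtain ⟨h₁, h₂⟩ := hz _ (sub_pos.2 hxz)
    exact ⟨h₁.trans_le (by gcongr), h₂.trans_le (by gcongr)⟩
  · rintro ⟨h₁, h₂⟩
    obtain ⟨z, hz, hzE⟩ := IsPreconnected.inter_support_restrict_nonempty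
      (convex_ball x ρ).isPreconnected hE h₁ h₂
    exact ⟨z, (mem_essBoundary_iff hE).2 hzE, Metric.mem_ball'.1 hz⟩

lemma oscBall_eq_indicator {N : ℕ} {E : Set (EuclideanSpace ℝ (Fin N))} (hE : MeasurableSet E)
    {ρ : ℝ} (hρ : 0 < ρ) :
    oscBall E ρ = (Metric.thickening ρ (essBoundary E)).indicator fun _ => 1 := by
  ext x
  have h₁ : volume.restrict (Metric.ball x ρ) E = volume (E ∩ Metric.ball x ρ) :=
    Measure.restrict_apply hE
  have h₂ : volume.restrict (Metric.ball x ρ) Eᶜ = volume (Metric.ball x ρ \ E) := by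
    rw [Measure.restrict_apply hE.compl, inter_comm, ← sdiff_eq]
  have hμ : volume.restrict (Metric.ball x ρ) ≠ 0 := by
    rw [Ne, Measure.restrict_eq_zero]
    exact (Metric.measure_ball_pos volume x hρ).ne'
  by_cases hx : x ∈ Metric.thickening ρ (essBoundary E)
  · obtain ⟨hE₁, hE₂⟩ := (mem_thickening_essBoundary_iff hE).1 hx
    rw [indicator_of_mem hx, oscBall, essSup_indicator_one (h₁ ▸ hE₁.ne'),
      essInf_indicator_one (h₂ ▸ hE₂.ne'), sub_zero]
  · rw [indicator_of_notMem hx]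
    rw [mem_thickening_essBoundary_iff hE, not_and_or, not_lt, not_lt, nonpos_iff_eq_zero,
      nonpos_iff_eq_zero, ← h₁, ← h₂] at hx
    obtain hx | hx := hx
    · exact essSup_sub_essInf_eq_zero_of_ae_eq_const hμ (indicator_meas_zero hx)
    · refine essSup_sub_essInf_eq_zero_of_ae_eq_const (c := 1) hμ ?_
      filter_upwards [mem_ae_iff.2 hx] with y hy using indicator_of_mem hy _

/-- For a measurable set `E` and `ρ > 0`, the set of points `x` such
that `B(x, ρ)` meets both `E` and its complement in positive measure coincides with the
open `ρ`-neighborhood of the essential boundary of `E`; consequently, the integral of the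
essential oscillation of `χ_E` over balls of radius `ρ` equals the Lebesgue measure of
that `ρ`-neighborhood. -/
theorem stmt17 (N : ℕ) (hN : 1 ≤ N)
    (E : Set (EuclideanSpace ℝ (Fin N))) (hE : MeasurableSet E) (ρ : ℝ) (hρ : 0 < ρ) :
    ({x : EuclideanSpace ℝ (Fin N) |
        0 < volume (E ∩ Metric.ball x ρ) ∧ 0 < volume (Metric.ball x ρ \ E)} =
      Metric.thickening ρ (essBoundary E)) ∧
    (∫⁻ x, ENNReal.ofReal (oscBall E ρ x) ∂volume =
      volume (Metric.thickening ρ (essBoundary E))) := by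
  refine ⟨ext fun x => (mem_thickening_essBoundary_iff hE).symm, ?_⟩
  rw [oscBall_eq_indicator hE hρ, ← lintegral_indicator_one Metric.isOpen_thickening.measurableSet]
  refine lintegral_congr fun x => ?_
  by_cases hx : x ∈ Metric.thickening ρ (essBoundary E) <;> simp [hx]
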